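/- arXiv:2109.11668 — 2 statements merged into one kernel-verified Lean document; each statement's English description precedes it below -/
import Mathlib

section
/- Let n ≥ 2 and p ≥ 2. The all-universal concept f_U, defined by f_U(x) = 1 for every x ∈ X, belongs to the class F_inc of incomplete scenarios, and every teaching set for f_U with respect to F_inc has cardinality at least n(n-1); that is, TDim(f_U, F_inc) ≥ n(n-1). -/
open Finset

/-- Unordered pairs of distinct entities among `n` entities. -/
abbrev Pairs (n : ℕ) := {s : Sym2 (Fin n) // ¬ s.IsDiag}

/-- The instance space `X = S × R`. -/
abbrev QInstance (n p : ℕ) := Pairs n × Fin p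

/-- `T` is a teaching set for `f` w.r.t. the concept class `F`:
every concept of `F` agreeing with `f` on `T` equals `f`. -/
def IsTeachingSet {n p : ℕ} (F : (QInstance n p → Bool) → Prop)
    (f : QInstance n p → Bool) (T : Finset (QInstance n p)) : Prop :=
  ∀ f', F f' → (∀ x ∈ T, f' x = f x) → f' = f

/-- The class `F_c` of complete scenarios. -/
def IsCompleteScenario {n p : ℕ} (f : QInstance n p → Bool) : Prop :=
  ∃ g : Pairs n → Fin p, ∀ s r, (f (s, r) = true ↔ g s = r)

/-- The class `F_inc` of incomplete scenarios (`none` encodes the universal relation). -/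
def IsIncomplete {n p : ℕ} (f : QInstance n p → Bool) : Prop :=
  ∃ g : Pairs n → Option (Fin p), ∀ s r, (f (s, r) = true ↔ (g s = none ∨ g s = some r))

/-- The class `F_all` of general QCN concepts. -/
def IsAll {n p : ℕ} (f : QInstance n p → Bool) : Prop :=
  ∃ g : Pairs n → Finset (Fin p), (∀ s, (g s).Nonempty) ∧ ∀ s r, (f (s, r) = true ↔ r ∈ g s)

/-- A teaching set for the all-universal concept contains at least two examples on each pair:
otherwise the scenario committing that pair to a single relation would not be excluded. -/
theorem two_le_card_fiber_of_isTeachingSet {n p : ℕ} (hp : 2 ≤ p) {T : Finset (QInstance n p)}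
    (hT : IsTeachingSet IsIncomplete (fun _ => true) T) (s : Pairs n) :
    2 ≤ #{x ∈ T | x.1 = s} := by
  by_contra! hlt
  have : Nonempty (QInstance n p) := ⟨(s, ⟨0, by omega⟩)⟩
  have : Nontrivial (Fin p) := Fin.nontrivial_iff_two_le.mpr hp
  obtain ⟨x₀, hx₀⟩ := Finset.card_le_one_iff_subset_singleton.mp (Nat.le_of_lt_succ hlt)
  have hagree : ∀ x ∈ T, x.1 = s → x.2 = x₀.2 := fun x hx hs => by
    rw [Finset.mem_singleton.mp (hx₀ (Finset.mem_filter.mpr ⟨hx, hs⟩))]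
  obtain ⟨r', hr'⟩ := exists_ne x₀.2
  have heq := hT (fun x => decide (x.1 = s → x.2 = x₀.2))
    ⟨fun t => if t = s then some x₀.2 else none, fun t r => by
      by_cases h : t = s <;> simp [h, eq_comm]⟩
    (fun x hx => decide_eq_true (hagree x hx))
  exact hr' (by simpa using congrFun heq (s, r'))

theorem card_pairs (n : ℕ) : Fintype.card (Pairs n) = n.choose 2 := by
  simpa using Sym2.card_subtype_not_diag (α := Fin n)

/-- the all-universal concept is in `F_inc` and needs at least
`n(n-1)` examples to teach. -/
theorem stmt_8 (n p : ℕ) (hn : 2 ≤ n) (hp : 2 ≤ p) :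
    IsIncomplete (fun _ : QInstance n p => true) ∧
    (∀ T : Finset (QInstance n p),
      IsTeachingSet IsIncomplete (fun _ => true) T → n * (n - 1) ≤ T.card) := by
  refine ⟨⟨fun _ => none, by simp⟩, fun T hT => ?_⟩
  calc n * (n - 1) = Fintype.card (Pairs n) * 2 := by
        rw [card_pairs, Nat.choose_two_right, Nat.div_mul_cancel (Nat.even_mul_pred_self n).two_dvd]
    _ ≤ ∑ s : Pairs n, #{x ∈ T | x.1 = s} := by
        simpa using Finset.card_nsmul_le_sum Finset.univ _ 2
          fun s _ => two_le_card_fiber_of_isTeachingSet hp hT s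
    _ = #T := (Finset.card_eq_sum_card_fiberwise fun _ _ => Finset.mem_coe.mpr (Finset.mem_univ _)).symm
end

section
/- Let n ≥ 2 and p ≥ 2, and let f_U be the all-universal concept defined by f_U(x) = 1 for every x ∈ X. Then f_U belongs to the class F_all of general QCN concepts, and the only teaching set for f_U with respect to F_all is X itself; in particular every teaching set for f_U has cardinality at least |X| = n(n-1)p/2. -/
open Finset

/-- Flipping the universal concept at a single instance stays inside `F_all`, since at least
one other relation remains possible for the corresponding pair. -/
theorem isAll_decide_ne {n p : ℕ} (hp : 2 ≤ p) (x : QInstance n p) :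
    IsAll (fun y => decide (y ≠ x)) := by
  refine ⟨fun s => Finset.univ.filter fun r => (s, r) ≠ x, fun s => ?_, fun s r => by simp⟩
  have : Nontrivial (Fin p) := Fin.nontrivial_iff_two_le.mpr hp
  obtain ⟨r, hr⟩ := exists_ne x.2
  exact ⟨r, by simpa using fun h : (s, r) = x => hr (congrArg Prod.snd h)⟩

theorem IsTeachingSet.eq_univ {n p : ℕ} (hp : 2 ≤ p) {T : Finset (QInstance n p)}
    (hT : IsTeachingSet IsAll (fun _ => true) T) : T = Finset.univ := by
  refine Finset.eq_univ_of_forall fun x => ?_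
  by_contra hx
  have h := hT _ (isAll_decide_ne hp x) fun y hy =>
    decide_eq_true fun hyx => hx (hyx ▸ hy)
  simpa using congrFun h x

theorem card_qInstance (n p : ℕ) : Fintype.card (QInstance n p) = n * (n - 1) * p / 2 := by
  rw [Fintype.card_prod, Sym2.card_subtype_not_diag, Fintype.card_fin, Fintype.card_fin,
    Nat.choose_two_right, Nat.div_mul_right_comm (Nat.even_mul_pred_self n).two_dvd]

/-- the all-universal concept is in `F_all` and its only teaching set
w.r.t. `F_all` is the whole instance space. -/
theorem stmt_11 (n p : ℕ) (hn : 2 ≤ n) (hp : 2 ≤ p) :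
    IsAll (fun _ : QInstance n p => true) ∧
    (∀ T : Finset (QInstance n p),
      IsTeachingSet IsAll (fun _ => true) T → T = Finset.univ) ∧
    (∀ T : Finset (QInstance n p),
      IsTeachingSet IsAll (fun _ => true) T → n * (n - 1) * p / 2 ≤ T.card) := by
  have : Nonempty (Fin p) := ⟨⟨0, by omega⟩⟩
  refine ⟨⟨fun _ => Finset.univ, fun _ => Finset.univ_nonempty, by simp⟩,
    fun T hT => hT.eq_univ hp, fun T hT => ?_⟩
  rw [hT.eq_univ hp, Finset.card_univ, card_qInstance]
end
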